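/- arXiv:2012.10580 — 3 statements merged into one kernel-verified Lean document; each statement's English description precedes it below -/
import Mathlib

section
/- Equality of noisy pushforward densities implies equality of noiseless pushforward densities: Let f, f̃ : ℝ^d → ℝ^d be C¹ diffeomorphisms, let q, q̃ be integrable probability densities on ℝ^d, and let p_ε be an integrable density on ℝ^d whose Fourier transform is nowhere zero. If ∫_{ℝ^d} q(z) p_ε(x − f(z)) dz = ∫_{ℝ^d} q̃(z) p_ε(x − f̃(z)) dz for almost every x ∈ ℝ^d, then q(f^{-1}(x)) · |det J_{f^{-1}}(x)| = q̃(f̃^{-1}(x)) · |det J_{f̃^{-1}}(x)| for almost every x ∈ ℝ^d. -/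
open MeasureTheory FourierTransform

namespace NoisyAux

open Convolution

variable {d : ℕ}

lemma changeVar {finv f : EuclideanSpace ℝ (Fin d) → EuclideanSpace ℝ (Fin d)}
    (hfinv : ContDiff ℝ 1 finv)
    (hfl : Function.LeftInverse finv f) (hfr : Function.RightInverse finv f)
    (G : EuclideanSpace ℝ (Fin d) → ℝ) :
    (Integrable G → Integrable (fun x => |(fderiv ℝ finv x).det| * G (finv x))) ∧
    ∫ z, G z = ∫ x, |(fderiv ℝ finv x).det| * G (finv x) := by
  have hd : ∀ x ∈ (Set.univ : Set (EuclideanSpace ℝ (Fin d))),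
      HasFDerivWithinAt finv (fderiv ℝ finv x) Set.univ x := fun x _ =>
    ((hfinv.differentiable (by simp)) x).hasFDerivAt.hasFDerivWithinAt
  have hinj : Set.InjOn finv Set.univ := hfr.injective.injOn
  have himg : finv '' Set.univ = Set.univ := by
    rw [Set.image_univ]; exact hfl.surjective.range_eq
  have h1 := integrableOn_image_iff_integrableOn_abs_det_fderiv_smul volume
    MeasurableSet.univ hd hinj G
  have h2 := integral_image_eq_integral_abs_det_fderiv_smul volume
    MeasurableSet.univ hd hinj G
  rw [himg] at h1 h2
  simp only [integrableOn_univ, Measure.restrict_univ, smul_eq_mul] at h1 h2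
  exact ⟨h1.1, h2⟩

lemma charFun_density (Q : EuclideanSpace ℝ (Fin d) → ℝ) (hQ : Integrable Q)
    (hQ0 : ∀ x, 0 ≤ Q x) (t : EuclideanSpace ℝ (Fin d)) :
    charFun (volume.withDensity fun x => ENNReal.ofReal (Q x)) t =
      𝓕 (fun x => (Q x : ℂ)) (-(2 * Real.pi)⁻¹ • t) := by
  rw [charFun_apply, Real.fourier_eq',
    integral_withDensity_eq_integral_toReal_smul₀ hQ.aestronglyMeasurable.aemeasurable.ennreal_ofReal
      (by simp)]
  congr 1
  ext x
  rw [ENNReal.toReal_ofReal (hQ0 x), inner_smul_right, smul_eq_mul, Complex.real_smul, mul_comm]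
  have : -2 * Real.pi * (-(2 * Real.pi)⁻¹ * inner ℝ x t) = inner ℝ x t := by
    field_simp
  rw [this]

lemma ae_eq_of_fourier (Q Q' : EuclideanSpace ℝ (Fin d) → ℝ) (hQ : Integrable Q)
    (hQ0 : ∀ x, 0 ≤ Q x) (hQ' : Integrable Q') (hQ'0 : ∀ x, 0 ≤ Q' x)
    (h : ∀ w, 𝓕 (fun x => (Q x : ℂ)) w = 𝓕 (fun x => (Q' x : ℂ)) w) :
    ∀ᵐ x, Q x = Q' x := by
  have := isFiniteMeasure_withDensity_ofReal hQ.2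
  have := isFiniteMeasure_withDensity_ofReal hQ'.2
  have key : volume.withDensity (fun x => ENNReal.ofReal (Q x)) =
      volume.withDensity (fun x => ENNReal.ofReal (Q' x)) := by
    apply Measure.ext_of_charFun
    ext t
    rw [charFun_density Q hQ hQ0, charFun_density Q' hQ' hQ'0, h]
  rw [withDensity_eq_iff_of_sigmaFinite hQ.aestronglyMeasurable.aemeasurable.ennreal_ofReal
    hQ'.aestronglyMeasurable.aemeasurable.ennreal_ofReal] at key
  filter_upwards [key] with x hx
  rwa [ENNReal.ofReal_eq_ofReal_iff (hQ0 x) (hQ'0 x)] at hx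

lemma conv_apply (Q p : EuclideanSpace ℝ (Fin d) → ℝ) (x : EuclideanSpace ℝ (Fin d)) :
    ((fun x => (Q x : ℂ)) ⋆[ContinuousLinearMap.mul ℂ ℂ] (fun x => (p x : ℂ))) x =
      ((∫ z, Q z * p (x - z) : ℝ) : ℂ) := by
  rw [convolution_def, ← integral_complex_ofReal]
  simp

lemma fourier_conv (Q p : EuclideanSpace ℝ (Fin d) → ℝ) (hQ : Integrable Q) (hp : Integrable p)
    (w : EuclideanSpace ℝ (Fin d)) :
    𝓕 (fun x => (Q x : ℂ)) w * 𝓕 (fun x => (p x : ℂ)) w =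
      𝓕 ((fun x => (Q x : ℂ)) ⋆[ContinuousLinearMap.mul ℂ ℂ] (fun x => (p x : ℂ))) w :=
  (Real.fourier_mul_convolution_eq (R := ℂ) hQ.ofReal hp.ofReal w).symm

end NoisyAux

/-- **Equality of noisy pushforward densities implies equality of noiseless
pushforward densities.** If the noise-convolved pushforward densities of `q` under
the C¹ diffeomorphism `f` and of `q̃` under `f̃` agree a.e., and the Fourier
transform of the noise density is nowhere zero, then the noiseless pushforward
densities `q(f⁻¹ x)·|det J_{f⁻¹}(x)|` and `q̃(f̃⁻¹ x)·|det J_{f̃⁻¹}(x)|` agree a.e. -/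
theorem noisy_pushforward_density_eq {d : ℕ}
    (f finv g ginv : EuclideanSpace ℝ (Fin d) → EuclideanSpace ℝ (Fin d))
    (hf : ContDiff ℝ 1 f) (hfinv : ContDiff ℝ 1 finv)
    (hfl : Function.LeftInverse finv f) (hfr : Function.RightInverse finv f)
    (hg : ContDiff ℝ 1 g) (hginv : ContDiff ℝ 1 ginv)
    (hgl : Function.LeftInverse ginv g) (hgr : Function.RightInverse ginv g)
    (q q' : EuclideanSpace ℝ (Fin d) → ℝ)
    (hq : Integrable q) (hq0 : ∀ z, 0 ≤ q z) (hq1 : (∫ z, q z) = 1)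
    (hq' : Integrable q') (hq'0 : ∀ z, 0 ≤ q' z) (hq'1 : (∫ z, q' z) = 1)
    (pε : EuclideanSpace ℝ (Fin d) → ℝ) (hpε : Integrable pε)
    (hF : ∀ ω : EuclideanSpace ℝ (Fin d), 𝓕 (fun x => (pε x : ℂ)) ω ≠ 0)
    (hobs : ∀ᵐ x : EuclideanSpace ℝ (Fin d),
      (∫ z, q z * pε (x - f z)) = ∫ z, q' z * pε (x - g z)) :
    ∀ᵐ x : EuclideanSpace ℝ (Fin d),
      q (finv x) * |(fderiv ℝ finv x).det| =
        q' (ginv x) * |(fderiv ℝ ginv x).det| := by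
  have hQ := (NoisyAux.changeVar hfinv hfl hfr q).1 hq
  have hQ' := (NoisyAux.changeVar hginv hgl hgr q').1 hq'
  have key := NoisyAux.ae_eq_of_fourier _ _ hQ
    (fun x => mul_nonneg (abs_nonneg _) (hq0 _)) hQ'
    (fun x => mul_nonneg (abs_nonneg _) (hq'0 _)) ?_
  · filter_upwards [key] with x hx
    rw [mul_comm, hx, mul_comm]
  intro w
  apply mul_right_cancel₀ (hF w)
  rw [NoisyAux.fourier_conv _ _ hQ hpε,
    NoisyAux.fourier_conv _ _ hQ' hpε, Real.fourier_eq', Real.fourier_eq']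
  apply integral_congr_ae
  filter_upwards [hobs] with x hx
  rw [(NoisyAux.changeVar hfinv hfl hfr (fun z => q z * pε (x - f z))).2,
    (NoisyAux.changeVar hginv hgl hgr (fun z => q' z * pε (x - g z))).2] at hx
  simp only [hfr _, hgr _, ← mul_assoc] at hx
  congr 1
  exact (NoisyAux.conv_apply _ _ x).trans
    ((congrArg Complex.ofReal hx).trans (NoisyAux.conv_apply _ _ x).symm)
end

section
/- Affine relation between sufficient statistics from exponential-family log-density equality: Let Y be a set, n a positive integer, and let T, T̃ : ℝ^D → ℝ^n, Γ, Γ̃ : Y → ℝ^n, B, B̃ : ℝ^D → ℝ, and A, Ã : Y → ℝ satisfy ⟨Γ(y), T(x)⟩ + B(x) − A(y) = ⟨Γ̃(y), T̃(x)⟩ + B̃(x) − Ã(y) for all x ∈ ℝ^D and all y ∈ Y. Suppose there exist labels y_0, y_1, …, y_n ∈ Y such that the n×n matrix L whose columns are Γ(y_1) − Γ(y_0), …, Γ(y_n) − Γ(y_0) is invertible, and let L̃ be the n×n matrix whose columns are Γ̃(y_1) − Γ̃(y_0), …, Γ̃(y_n) − Γ̃(y_0). Then T(x) = (Lᵀ)^{-1}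 L̃ᵀ T̃(x) + c for all x ∈ ℝ^D, where c := (Lᵀ)^{-1} · ( (A(y_i) − A(y_0)) − (Ã(y_i) − Ã(y_0)) )_{i=1,…,n} ∈ ℝ^n. In particular, there exist a matrix M ∈ ℝ^{n×n} and a vector c ∈ ℝ^n with T(x) = M T̃(x) + c for all x. -/
open Finset

/-- **Affine relation between sufficient statistics from exponential-family
log-density equality.** If `⟨Γ(y), T(x)⟩ + B(x) − A(y) = ⟨Γ̃(y), T̃(x)⟩ + B̃(x) − Ã(y)`
for all `x, y`, and the matrix `L` with columns `Γ(yᵢ) − Γ(y₀)` is invertible, then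
`T(x) = (Lᵀ)⁻¹ L̃ᵀ T̃(x) + c` with `c = (Lᵀ)⁻¹ ((A(yᵢ) − A(y₀)) − (Ã(yᵢ) − Ã(y₀)))ᵢ`. -/
theorem affine_relation_of_log_density_eq {Y : Type*} {n D : ℕ}
    (T T' : (Fin D → ℝ) → Fin n → ℝ)
    (Γ Γ' : Y → Fin n → ℝ) (B B' : (Fin D → ℝ) → ℝ) (A A' : Y → ℝ)
    (heq : ∀ (x : Fin D → ℝ) (y : Y),
      (∑ i, Γ y i * T x i) + B x - A y = (∑ i, Γ' y i * T' x i) + B' x - A' y)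
    (y₀ : Y) (ys : Fin n → Y)
    (L L' : Matrix (Fin n) (Fin n) ℝ)
    (hL : L = Matrix.of fun i j => Γ (ys j) i - Γ y₀ i)
    (hL' : L' = Matrix.of fun i j => Γ' (ys j) i - Γ' y₀ i)
    (hLinv : IsUnit L) :
    ∀ x, T x = (L.transpose⁻¹ * L'.transpose).mulVec (T' x) +
      L.transpose⁻¹.mulVec (fun i => (A (ys i) - A y₀) - (A' (ys i) - A' y₀)) := by
  intro x
  have hdet : IsUnit L.transpose.det := by
    rw [Matrix.det_transpose]
    exact (Matrix.isUnit_iff_isUnit_det L).mp hLinv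
  have key : L.transpose.mulVec (T x) = L'.transpose.mulVec (T' x) +
      (fun i => (A (ys i) - A y₀) - (A' (ys i) - A' y₀)) := by
    funext i
    have h1 := heq x (ys i)
    have h0 := heq x y₀
    simp only [hL, hL', Matrix.mulVec, dotProduct, Pi.add_apply, Matrix.transpose_apply,
      Matrix.of_apply, sub_mul, Finset.sum_sub_distrib]
    linarith
  rw [← Matrix.mulVec_mulVec, ← Matrix.mulVec_add, ← key, Matrix.mulVec_mulVec,
    Matrix.nonsing_inv_mul _ hdet, Matrix.one_mulVec]
end

section
/- Identifiability in the deterministic (noiseless auto-encoder) setting: Let θ = (T, Γ, B, A, f) and θ̃ = (T̃, Γ̃, B̃, Ã, f̃) be two noiseless parameter tuples for the latent generative model. Assume there exist n+1 labels y_0, y_1, …, y_n in Y (where n = k·d) such that both the n×n matrix with columns Γ(y_1) − Γ(y_0), …, Γ(y_n) − Γ(y_0) and the n×n matrix with columns Γ̃(y_1) − Γ̃(y_0), …, Γ̃(y_n) − Γ̃(y_0) are invertible. If the observational conditional densities agree, i.e. p_θ(f(z') | y) evaluated via the pushforward formula satisfies exp(⟨Γ(y), T(f^{-1}(x))⟩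 + B(f^{-1}(x)) − A(y)) · |det J_{f^{-1}}(x)| = exp(⟨Γ̃(y), T̃(f̃^{-1}(x))⟩ + B̃(f̃^{-1}(x)) − Ã(y)) · |det J_{f̃^{-1}}(x)| for all x ∈ ℝ^d and all y ∈ Y, then there exist an invertible n×n real matrix A and a vector b ∈ ℝ^n such that T(f^{-1}(x)) = A · T̃(f̃^{-1}(x)) + b for all x ∈ ℝ^d. -/
open MeasureTheory Finset

/-- The derivative of a `C¹` map with a `C¹` left inverse has nonzero determinant. -/
lemma det_fderiv_ne_zero_aux {d : ℕ}
    (f finv : EuclideanSpace ℝ (Fin d) → EuclideanSpace ℝ (Fin d))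
    (hf : ContDiff ℝ 1 f) (hfinv : ContDiff ℝ 1 finv)
    (hfr : Function.RightInverse finv f) (x : EuclideanSpace ℝ (Fin d)) :
    (fderiv ℝ finv x).det ≠ 0 := by
  have h1 : HasFDerivAt finv (fderiv ℝ finv x) x :=
    (hfinv.differentiable one_ne_zero x).hasFDerivAt
  have h2 : HasFDerivAt f (fderiv ℝ f (finv x)) (finv x) :=
    (hf.differentiable one_ne_zero (finv x)).hasFDerivAt
  have h3 := h2.comp x h1
  have h4 : f ∘ finv = id := funext hfr
  rw [h4] at h3
  have h5 := h3.unique (hasFDerivAt_id x)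
  have h6 : LinearMap.det ((fderiv ℝ f (finv x)).toLinearMap ∘ₗ (fderiv ℝ finv x).toLinearMap)
      = 1 := by
    rw [← ContinuousLinearMap.toLinearMap_comp, h5]
    exact LinearMap.det_id
  rw [LinearMap.det_comp] at h6
  intro h0
  have h0' : LinearMap.det (fderiv ℝ finv x).toLinearMap = 0 := h0
  rw [h0', mul_zero] at h6
  exact zero_ne_one h6

/-- **Identifiability in the deterministic (noiseless auto-encoder) setting.**
Two noiseless parameter tuples `θ = (T, Γ, B, A, f)` and `θ̃ = (T', Γ', B', A', g)`
with `n = k·d`, where `f, g` are C¹ diffeomorphisms with inverses `finv, ginv` and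
each conditional prior `exp(⟨Γ(y), T(z)⟩ + B(z) − A(y))` is a probability density.
Assume there are `n + 1` labels `y₀, ys 0, …, ys (n-1)` such that both matrices of
natural-parameter differences (for `Γ` and for `Γ'`) are invertible. If the
pushforward (observational) densities agree for all `x` and `y`, then `T ∘ f⁻¹`
and `T̃ ∘ f̃⁻¹` are related by an invertible affine transformation. -/
theorem intele_identifiability_deterministic {d k : ℕ} (hd : 0 < d) (hk : 0 < k)
    {Y : Type*} [Fintype Y]
    -- parameters θ
    (T : EuclideanSpace ℝ (Fin d) → Fin (k * d) → ℝ)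
    (Γ : Y → Fin (k * d) → ℝ)
    (B : EuclideanSpace ℝ (Fin d) → ℝ) (A : Y → ℝ)
    (f finv : EuclideanSpace ℝ (Fin d) → EuclideanSpace ℝ (Fin d))
    -- parameters θ̃
    (T' : EuclideanSpace ℝ (Fin d) → Fin (k * d) → ℝ)
    (Γ' : Y → Fin (k * d) → ℝ)
    (B' : EuclideanSpace ℝ (Fin d) → ℝ) (A' : Y → ℝ)
    (g ginv : EuclideanSpace ℝ (Fin d) → EuclideanSpace ℝ (Fin d))
    -- the mixing maps are C¹ diffeomorphisms
    (hf : ContDiff ℝ 1 f) (hfinv : ContDiff ℝ 1 finv)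
    (hfl : Function.LeftInverse finv f) (hfr : Function.RightInverse finv f)
    (hg : ContDiff ℝ 1 g) (hginv : ContDiff ℝ 1 ginv)
    (hgl : Function.LeftInverse ginv g) (hgr : Function.RightInverse ginv g)
    -- the conditional priors are probability densities
    (hdens : ∀ y : Y,
      (∫ z, Real.exp ((∑ i, Γ y i * T z i) + B z - A y)) = 1)
    (hdens' : ∀ y : Y,
      (∫ z, Real.exp ((∑ i, Γ' y i * T' z i) + B' z - A' y)) = 1)
    -- n + 1 labels for which both natural-parameter difference matrices are invertible
    (hb : ∃ (y₀ : Y) (ys : Fin (k * d) → Y),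
      IsUnit (Matrix.of (fun i j => Γ (ys j) i - Γ y₀ i) :
        Matrix (Fin (k * d)) (Fin (k * d)) ℝ) ∧
      IsUnit (Matrix.of (fun i j => Γ' (ys j) i - Γ' y₀ i) :
        Matrix (Fin (k * d)) (Fin (k * d)) ℝ))
    -- equality of the noiseless (pushforward) observational densities
    (hobs : ∀ (x : EuclideanSpace ℝ (Fin d)) (y : Y),
      Real.exp ((∑ i, Γ y i * T (finv x) i) + B (finv x) - A y) *
          |(fderiv ℝ finv x).det| =
        Real.exp ((∑ i, Γ' y i * T' (ginv x) i) + B' (ginv x) - A' y) *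
          |(fderiv ℝ ginv x).det|) :
    ∃ M : Matrix (Fin (k * d)) (Fin (k * d)) ℝ, IsUnit M ∧
      ∃ b : Fin (k * d) → ℝ,
        ∀ x : EuclideanSpace ℝ (Fin d),
          T (finv x) = M.mulVec (T' (ginv x)) + b := by
  obtain ⟨y₀, ys, hL, hL'⟩ := hb
  set L : Matrix (Fin (k * d)) (Fin (k * d)) ℝ :=
    Matrix.of (fun i j => Γ (ys j) i - Γ y₀ i) with hLdef
  set L' : Matrix (Fin (k * d)) (Fin (k * d)) ℝ :=
    Matrix.of (fun i j => Γ' (ys j) i - Γ' y₀ i) with hLdef'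
  have hLt : IsUnit L.transpose.det := by
    rw [Matrix.det_transpose]; exact (Matrix.isUnit_iff_isUnit_det _).1 hL
  have hLt' : IsUnit L'.transpose.det := by
    rw [Matrix.det_transpose]; exact (Matrix.isUnit_iff_isUnit_det _).1 hL'
  have hlog : ∀ x y, (∑ i, Γ y i * T (finv x) i) + B (finv x) - A y +
      Real.log |(fderiv ℝ finv x).det| =
      (∑ i, Γ' y i * T' (ginv x) i) + B' (ginv x) - A' y +
      Real.log |(fderiv ℝ ginv x).det| := by
    intro x y
    have h := congrArg Real.log (hobs x y)
    rwa [Real.log_mul (Real.exp_ne_zero _)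
        (abs_ne_zero.2 (det_fderiv_ne_zero_aux f finv hf hfinv hfr x)),
      Real.log_mul (Real.exp_ne_zero _)
        (abs_ne_zero.2 (det_fderiv_ne_zero_aux g ginv hg hginv hgr x)),
      Real.log_exp, Real.log_exp] at h
  let c : Fin (k * d) → ℝ := fun j => (A (ys j) - A y₀) - (A' (ys j) - A' y₀)
  have hkey : ∀ x, L.transpose.mulVec (T (finv x)) = L'.transpose.mulVec (T' (ginv x)) + c := by
    intro x
    funext j
    have h1 := hlog x (ys j)
    have h0 := hlog x y₀
    simp only [Matrix.mulVec, dotProduct, Pi.add_apply, Matrix.transpose_apply, hLdef, hLdef',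
      Matrix.of_apply, sub_mul, Finset.sum_sub_distrib, c]
    linarith
  refine ⟨L.transpose⁻¹ * L'.transpose, ?_, L.transpose⁻¹.mulVec c, ?_⟩
  · rw [Matrix.isUnit_iff_isUnit_det, Matrix.det_mul]
    exact (Matrix.isUnit_nonsing_inv_det _ hLt).mul hLt'
  · intro x
    rw [← Matrix.mulVec_mulVec, ← Matrix.mulVec_add, ← hkey x, Matrix.mulVec_mulVec,
      Matrix.nonsing_inv_mul _ hLt, Matrix.one_mulVec]
end
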